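/- Fix integers ν ≥ d ≥ 2. There exists a constant C = C(ν) > 0 such that for every integer h ≥ 3 and every algebraic number σ ∈ ℂ of degree d over ℚ, the number N_ν(h,σ) of tuples of integers (x_1,…,x_ν,y_1,…,y_ν) with 1 ≤ x_i, y_i ≤ h satisfying (x_1+σ)⋯(x_ν+σ) = (y_1+σ)⋯(y_ν+σ) ≠ 0 and {x_1,…,x_ν} ∩ {y_1,…,y_ν} = ∅ satisfies N_ν(h,σ) ≤ h^{ν−d+1}·exp(C·log h/log log h). -/

import Mathlib

section

open Polynomial

/-- The Mahler measure is bounded by the supremum on the unit circle. -/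
theorem mahlerMeasure_le_of_norm_eval_le {p : ℂ[X]} (hp : p ≠ 0) {B : ℝ} (hB1 : 1 ≤ B)
    (hB : ∀ z : ℂ, ‖z‖ = 1 → ‖p.eval z‖ ≤ B) : p.mahlerMeasure ≤ B := by
  rw [mahlerMeasure_def_of_ne_zero hp, ← Real.le_log_iff_exp_le (by linarith),
    ← smul_eq_mul, ← Real.circleAverage_def (f := fun z => Real.log ‖p.eval z‖)]
  apply Real.circleAverage_mono_on_of_le_circle
  · exact (analyticOnNhd_id.aeval_polynomial p).meromorphicOn.circleIntegrable_log_norm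
  · intro z hz
    by_cases h0 : p.eval z = 0
    · simpa [h0] using Real.log_nonneg hB1
    · exact Real.log_le_log (by simpa using h0) (hB z (by simpa using hz))

theorem norm_eval_le_two_pow_mul_mahlerMeasure (p : ℂ[X]) {z : ℂ} (hz : ‖z‖ ≤ 1) :
    ‖p.eval z‖ ≤ 2 ^ p.natDegree * p.mahlerMeasure := by
  rw [(IsAlgClosed.splits p).eval_eq_prod_roots, mahlerMeasure_eq_leadingCoeff_mul_prod_roots,
    ← (IsAlgClosed.card_roots_eq_natDegree (p := p)), norm_mul, mul_left_comm]
  gcongr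
  induction p.roots using Multiset.induction_on with
  | empty => simp
  | cons a s ih =>
    simp only [Multiset.map_cons, Multiset.prod_cons, norm_mul, Multiset.card_cons, pow_succ]
    have h1 : ‖z - a‖ ≤ 2 * max 1 ‖a‖ := by
      have := norm_sub_le z a
      have := le_max_left 1 ‖a‖
      have := le_max_right 1 ‖a‖
      linarith
    calc _ ≤ (2 * max 1 ‖a‖) * (2 ^ Multiset.card s * (s.map fun a => max 1 ‖a‖).prod) := by
          gcongr
      _ = _ := by ring

theorem norm_aeval_mul_pow_le {p q : ℤ[X]} (hp : p ≠ 0) (hq : q ≠ 0) {h B : ℝ} (hh : 0 < h)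
    (hB1 : 1 ≤ B)     (hB : ∀ w : ℂ, ‖w‖ = h → ‖aeval w (p * q)‖ ≤ B) {w : ℂ} (hw : ‖w‖ ≤ h) :
    ‖aeval w q‖ * h ^ p.natDegree ≤ 2 ^ q.natDegree * B := by
  let s : ℤ[X] → ℂ[X] := fun r => (r.map (Int.castRingHom ℂ)).comp (C (h : ℂ) * X)
  have hhc : (h : ℂ) ≠ 0 := by exact_mod_cast hh.ne'
  have hev : ∀ r z, (s r).eval z = aeval (h * z) r := by
    intro r z
    simp [s, eval_comp, aeval_def, eval₂_eq_eval_map]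
  have hdegX : (C (h : ℂ) * X).natDegree = 1 := natDegree_C_mul_X _ hhc
  have hdeg : ∀ r, (s r).natDegree = r.natDegree := by
    intro r
    rw [natDegree_comp, hdegX, mul_one, natDegree_map_eq_of_injective Int.cast_injective]
  have hlead : ∀ r, (s r).leadingCoeff = r.leadingCoeff * (h : ℂ) ^ r.natDegree := by
    intro r
    rw [leadingCoeff_comp (by simp [hdegX]), leadingCoeff_map_of_injective Int.cast_injective,
      natDegree_map_eq_of_injective Int.cast_injective, leadingCoeff_C_mul_X]
    simp
  have hne : ∀ r, r ≠ 0 → s r ≠ 0 := by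
    intro r hr h0
    have := hlead r
    rw [h0] at this
    simp [hr, hhc] at this
  have hmul : s (p * q) = s p * s q := by simp [s]
  have h1 : (s (p * q)).mahlerMeasure ≤ B := by
    apply mahlerMeasure_le_of_norm_eval_le (hne _ (mul_ne_zero hp hq)) hB1
    intro z hz
    rw [hev]
    apply hB
    simp [hz, abs_of_pos hh]
  rw [hmul, mahlerMeasure_mul] at h1
  have h2 : h ^ p.natDegree ≤ (s p).mahlerMeasure := by
    refine le_trans ?_ (leadingCoeff_le_mahlerMeasure _)
    rw [hlead, norm_mul, norm_pow, Complex.norm_real, Real.norm_of_nonneg hh.le]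
    have : (1 : ℝ) ≤ ‖(p.leadingCoeff : ℂ)‖ := by
      rw [Complex.norm_intCast]
      exact_mod_cast Int.one_le_abs (leadingCoeff_ne_zero.2 hp)
    nlinarith [pow_pos hh p.natDegree]
  have h3 : ‖aeval w q‖ ≤ 2 ^ q.natDegree * (s q).mahlerMeasure := by
    have := norm_eval_le_two_pow_mul_mahlerMeasure (s q) (z := w / h)
      (by rw [norm_div, Complex.norm_real, Real.norm_of_nonneg hh.le]; exact (div_le_one hh).2 hw)
    rwa [hev, hdeg, mul_div_cancel₀ _ hhc] at this
  calc ‖aeval w q‖ * h ^ p.natDegree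
      ≤ (2 ^ q.natDegree * (s q).mahlerMeasure) * (s p).mahlerMeasure := by
        gcongr
        exact mul_nonneg (by positivity) (mahlerMeasure_nonneg _)
    _ = 2 ^ q.natDegree * ((s p).mahlerMeasure * (s q).mahlerMeasure) := by ring
    _ ≤ _ := by gcongr

theorem prod_eval_neg_eq {n : ℕ} {m g : ℤ[X]} {x y : Fin n → ℤ}
    (h : ∏ i, (X + C (x i)) - ∏ i, (X + C (y i)) = m * g) :
    ∏ i, m.eval (-x i) = ∏ i, m.eval (-y i) := by
  set mc := m.map (Int.castRingHom ℂ) with hmc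
  have key : ∀ z : Fin n → ℤ, ((∏ i, m.eval (-z i) : ℤ) : ℂ) =
      mc.leadingCoeff ^ n * (mc.roots.map fun r => (-1) ^ n * ∏ i, (r + (z i : ℂ))).prod := by
    intro z
    have h1 : ∀ i, ((m.eval (-z i) : ℤ) : ℂ) =
        mc.leadingCoeff * (mc.roots.map fun r => -1 * (r + (z i : ℂ))).prod := by
      intro i
      have h2 : ((m.eval (-z i) : ℤ) : ℂ) = mc.eval (-(z i : ℂ)) := by
        have := (eval_intCast_map (Int.castRingHom ℂ) m (-z i))
        simpa [hmc] using this.symm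
      rw [h2, (IsAlgClosed.splits mc).eval_eq_prod_roots]
      congr 3
      ext r
      ring
    rw [Int.cast_prod, Finset.prod_congr rfl fun i _ => h1 i, Finset.prod_mul_distrib]
    congr 1
    · simp
    · refine (Multiset.prod_map_prod_map Finset.univ.val mc.roots).trans ?_
      congr 2
      ext r
      exact Finset.prod_mul_distrib.trans (by simp)
  have hC : ((∏ i, m.eval (-x i) : ℤ) : ℂ) = ((∏ i, m.eval (-y i) : ℤ) : ℂ) := by
    rw [key, key]
    congr 2
    apply Multiset.map_congr rfl
    intro r hr
    have hr0 : mc.eval r = 0 := (mem_roots'.1 hr).2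
    have h4 := congrArg (fun p => (p.map (Int.castRingHom ℂ)).eval r) h
    simp only [Polynomial.map_mul, Polynomial.map_sub, Polynomial.map_prod, eval_mul, eval_sub,
      ← hmc, hr0, eval_prod] at h4
    simp [sub_eq_zero] at h4
    rw [h4]
  exact_mod_cast hC

/-- At most `2 deg p` integers give each divisor of `A`, up to sign, as the value `p(-y)`. -/
theorem card_filter_eval_neg_dvd_le {p : ℤ[X]} (hp : 0 < p.natDegree) {A : ℤ} (hA : A ≠ 0)
    (s : Finset ℤ) :
    (s.filter fun y => p.eval (-y) ∣ A).card ≤ 2 * p.natDegree * A.natAbs.divisors.card := by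
  apply Finset.card_le_mul_card_image_of_maps_to (f := fun y => (p.eval (-y)).natAbs)
  · intro y hy
    rw [Nat.mem_divisors]
    exact ⟨Int.natAbs_dvd_natAbs.2 (Finset.mem_filter.1 hy).2, by simpa using hA⟩
  · intro δ _
    have hb : ∀ c : ℤ, (p - C c).roots.toFinset.card ≤ p.natDegree ∧ p - C c ≠ 0 := by
      intro c
      refine ⟨(Multiset.toFinset_card_le _).trans ((card_roots' _).trans ?_), ?_⟩
      · rw [natDegree_sub_C]
      · intro h
        have := natDegree_sub_C (p := p) (a := c)
        rw [h] at this
        simp at this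
        omega
    refine (Finset.card_le_card (t := ((p - C (δ : ℤ)).roots.toFinset ∪
      (p - C (-δ : ℤ)).roots.toFinset).image Neg.neg) ?_).trans
      (Finset.card_image_le.trans ((Finset.card_union_le _ _).trans ?_))
    · intro y hy
      have hy2 : (p.eval (-y)).natAbs = δ := (Finset.mem_filter.1 hy).2
      rw [Finset.mem_image]
      refine ⟨-y, ?_, neg_neg y⟩
      rw [Finset.mem_union, Multiset.mem_toFinset, Multiset.mem_toFinset, mem_roots (hb _).2,
        mem_roots (hb _).2]
      simp only [IsRoot.def, eval_sub, eval_C]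
      omega
    · have := (hb δ).1
      have := (hb (-δ)).1
      omega

theorem exists_int_polynomial_dvd_of_aeval_eq_zero {σ : ℂ} (hσ : IsIntegral ℚ σ)
    (hd : 2 ≤ (minpoly ℚ σ).natDegree) :
    ∃ m : ℤ[X], m ≠ 0 ∧ m.natDegree = (minpoly ℚ σ).natDegree ∧ (∀ a : ℤ, m.eval a ≠ 0) ∧
      ∀ F : ℤ[X], aeval σ F = 0 → m ∣ F := by
  set p := minpoly ℚ σ with hp
  have hp0 : p ≠ 0 := minpoly.ne_zero hσ
  obtain ⟨b, hb, hN⟩ := IsLocalization.integerNormalization_spec (nonZeroDivisors ℤ) p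
  set N := IsLocalization.integerNormalization (nonZeroDivisors ℤ) p
  have hb0 : (b : ℚ) ≠ 0 := by exact_mod_cast nonZeroDivisors.ne_zero hb
  have hNp : N.map (Int.castRingHom ℚ) = C (b : ℚ) * p := by
    have : N.map (Int.castRingHom ℚ) = b • p := hN
    rw [this, zsmul_eq_mul, ← C_eq_intCast]
  have hN0 : N ≠ 0 := by
    intro h
    rw [h, Polynomial.map_zero] at hNp
    exact mul_ne_zero (C_ne_zero.2 hb0) hp0 hNp.symm
  have hmp : C (N.content : ℚ) * N.primPart.map (Int.castRingHom ℚ) = C (b : ℚ) * p := by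
    rw [← hNp]
    conv_rhs => rw [N.eq_C_content_mul_primPart]
    simp
  have hdeg : N.primPart.natDegree = p.natDegree := by
    rw [natDegree_primPart, ← natDegree_map_eq_of_injective (f := Int.castRingHom ℚ)
      Int.cast_injective, hNp, natDegree_C_mul hb0]
  refine ⟨N.primPart, N.isPrimitive_primPart.ne_zero, hdeg, ?_, ?_⟩
  · intro a ha
    have h1 := congrArg (eval (a : ℚ)) hmp
    have h2 : (N.primPart.map (Int.castRingHom ℚ)).eval (a : ℚ) = 0 := by
      simp [ha]
    rw [eval_mul, h2, mul_zero, eval_C_mul, zero_eq_mul] at h1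
    have h3 := degree_eq_one_of_irreducible_of_root (minpoly.irreducible hσ)
      (h1.resolve_left hb0)
    have h4 : p.natDegree = 1 := natDegree_eq_of_degree_eq_some h3
    omega
  · intro F hF
    rw [IsPrimitive.Int.dvd_iff_map_cast_dvd_map_cast _ _ N.isPrimitive_primPart]
    have h1 : p ∣ F.map (Int.castRingHom ℚ) := by
      apply minpoly.dvd
      rw [← hF]
      exact aeval_map_algebraMap ℚ σ F
    refine (Dvd.intro_left _ hmp).trans ?_
    rwa [(isUnit_C.2 hb0.isUnit).mul_left_dvd]

theorem norm_aeval_prod_sub_prod_le {n h : ℕ} {x y : Fin n → ℤ}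
    (hx : ∀ i, 1 ≤ x i ∧ x i ≤ (h : ℤ)) (hy : ∀ i, 1 ≤ y i ∧ y i ≤ (h : ℤ)) {w : ℂ}
    (hw : ‖w‖ = h) :
    ‖aeval w (∏ i, (X + C (x i)) - ∏ i, (X + C (y i)) : ℤ[X])‖ ≤ 2 ^ (n + 1) * (h : ℝ) ^ n := by
  have key : ∀ z : Fin n → ℤ, (∀ i, 1 ≤ z i ∧ z i ≤ (h : ℤ)) →
      ‖aeval w (∏ i, (X + C (z i)) : ℤ[X])‖ ≤ (2 * h : ℝ) ^ n := by
    intro z hz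
    rw [map_prod, norm_prod]
    refine (Finset.prod_le_prod (g := fun _ => (2 * h : ℝ)) (fun _ _ => norm_nonneg _) ?_).trans
      (by simp)
    intro i _
    have h1 : ‖((z i : ℤ) : ℂ)‖ ≤ h := by
      rw [Complex.norm_intCast, abs_of_nonneg (by exact_mod_cast (by linarith [hz i] : 0 ≤ z i))]
      exact_mod_cast (hz i).2
    have h2 : aeval w (X + C (z i) : ℤ[X]) = w + (z i : ℂ) := by simp
    rw [h2]
    linarith [norm_add_le w (z i : ℂ)]
  rw [map_sub]
  refine (norm_sub_le _ _).trans ((add_le_add (key x hx) (key y hy)).trans (le_of_eq ?_))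
  ring

/-- Size bounds for the two factors of `∏ (T + xᵢ) - ∏ (T + yᵢ) = m(T) g(T)` on `|T| ≤ h`. -/
theorem natAbs_eval_neg_le {n h : ℕ} (hh : 1 ≤ h) {x y : Fin n → ℤ}
    (hx : ∀ i, 1 ≤ x i ∧ x i ≤ (h : ℤ)) (hy : ∀ i, 1 ≤ y i ∧ y i ≤ (h : ℤ)) {m g : ℤ[X]}
    (hm : m ≠ 0) (hg : g ≠ 0) (hmn : m.natDegree ≤ n)
    (hF : ∏ i, (X + C (x i)) - ∏ i, (X + C (y i)) = m * g)
    {w : ℤ} (hw : 1 ≤ w ∧ w ≤ (h : ℤ)) :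
    (m.eval (-w)).natAbs ≤ 2 ^ (2 * n + 1) * h ^ n ∧
      (g.eval (-w)).natAbs ≤ 2 ^ (2 * n + 1) * h ^ (n - m.natDegree) := by
  have hh0 : (0 : ℝ) < h := by exact_mod_cast hh
  have hh1 : (1 : ℝ) ≤ h := by exact_mod_cast hh
  have hB1 : (1 : ℝ) ≤ 2 ^ (n + 1) * (h : ℝ) ^ n :=
    one_le_mul_of_one_le_of_one_le (one_le_pow₀ (by norm_num)) (one_le_pow₀ hh1)
  have hwn : ‖(-(w : ℂ))‖ ≤ h := by
    rw [norm_neg, Complex.norm_intCast,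
      abs_of_nonneg (by exact_mod_cast (by linarith : 0 ≤ w))]
    exact_mod_cast hw.2
  have hev : ∀ r : ℤ[X], ‖aeval (-(w : ℂ)) r‖ = ((r.eval (-w)).natAbs : ℝ) := by
    intro r
    have h1 : aeval (-(w : ℂ)) r = ((r.eval (-w) : ℤ) : ℂ) := by
      have := aeval_algebraMap_apply ℂ (-w) r
      simpa using this
    rw [h1, Complex.norm_intCast, Nat.cast_natAbs, Int.cast_abs]
  have hdeg : m.natDegree + g.natDegree ≤ n := by
    rw [← natDegree_mul hm hg, ← hF]
    have : ∀ z : Fin n → ℤ, (∏ i, (X + C (z i))).natDegree ≤ n := by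
      intro z
      refine (natDegree_prod_le _ _).trans ?_
      simp only [natDegree_X_add_C]
      simp
    exact (natDegree_sub_le _ _).trans (max_le (this x) (this y))
  constructor
  · have h1 := norm_aeval_mul_pow_le hg hm hh0 hB1
      (fun w hw => by rw [mul_comm, ← hF]; exact norm_aeval_prod_sub_prod_le hx hy hw) hwn
    rw [hev] at h1
    have h2 : ((m.eval (-w)).natAbs : ℝ) ≤ 2 ^ (2 * n + 1) * (h : ℝ) ^ n := by
      calc ((m.eval (-w)).natAbs : ℝ) ≤ ((m.eval (-w)).natAbs : ℝ) * h ^ g.natDegree :=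
            le_mul_of_one_le_right (by positivity) (one_le_pow₀ hh1)
        _ ≤ _ := h1
        _ ≤ 2 ^ n * (2 ^ (n + 1) * (h : ℝ) ^ n) := by gcongr; norm_num
        _ = _ := by ring
    exact_mod_cast h2
  · have h1 := norm_aeval_mul_pow_le hm hg hh0 hB1
      (fun w hw => by rw [← hF]; exact norm_aeval_prod_sub_prod_le hx hy hw) hwn
    rw [hev] at h1
    have h2 : ((g.eval (-w)).natAbs : ℝ) ≤ 2 ^ (2 * n + 1) * (h : ℝ) ^ (n - m.natDegree) := by
      refine le_of_mul_le_mul_right ?_ (pow_pos hh0 m.natDegree)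
      calc _ ≤ _ := h1
        _ ≤ 2 ^ n * (2 ^ (n + 1) * (h : ℝ) ^ n) := by gcongr; norm_num; omega
        _ = 2 ^ (2 * n + 1) * ((h : ℝ) ^ (n - m.natDegree) * h ^ m.natDegree) := by
          rw [pow_sub_mul_pow _ hmn]; ring
        _ = _ := by ring
    exact_mod_cast h2

theorem card_piFinset_filter_eval_neg_dvd_le {n : ℕ} {p : ℤ[X]} (hp : 0 < p.natDegree) {A : ℤ}
    (hA : A ≠ 0) (s : Finset ℤ) {D : ℕ} (hD : A.natAbs.divisors.card ≤ D) :
    (Fintype.piFinset fun _ : Fin n => s.filter fun y => p.eval (-y) ∣ A).card ≤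
      (2 * p.natDegree * D) ^ n := by
  rw [Fintype.card_piFinset_const]
  exact Nat.pow_le_pow_left
    ((card_filter_eval_neg_dvd_le hp hA s).trans (Nat.mul_le_mul_left _ hD)) _

theorem ncard_prod_eq_prod_le {ν d : ℕ} (hd : 2 ≤ d) (hdν : d ≤ ν) {h : ℕ} (hh : 3 ≤ h) {σ : ℂ}
    (hσ : IsIntegral ℚ σ) (hσd : (minpoly ℚ σ).natDegree = d) {D : ℕ}
    (hD : ∀ n : ℕ, n ≠ 0 → n ≤ h ^ ((3 * ν + 1) * (ν + 2)) → n.divisors.card ≤ D) :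
    Set.ncard {xy : (Fin ν → ℤ) × (Fin ν → ℤ) |
          (∀ i, 1 ≤ xy.1 i ∧ xy.1 i ≤ (h : ℤ)) ∧
          (∀ i, 1 ≤ xy.2 i ∧ xy.2 i ≤ (h : ℤ)) ∧
          (∏ i, ((xy.1 i : ℂ) + σ)) = (∏ i, ((xy.2 i : ℂ) + σ)) ∧
          (∏ i, ((xy.1 i : ℂ) + σ)) ≠ 0 ∧
          (∀ i j, xy.1 i ≠ xy.2 j)} ≤
      h * (2 * (2 ^ (2 * ν + 1) * h ^ (ν - d))) * ((2 * D) ^ ν * (2 * d * D) ^ ν) := by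
  classical
  set S := {xy : (Fin ν → ℤ) × (Fin ν → ℤ) | _} with hS
  rcases S.eq_empty_or_nonempty with hemp | hne
  · rw [hemp, Set.ncard_empty]
    exact Nat.zero_le _
  obtain ⟨m, hm0, hmd, hmroot, hmdvd⟩ :=
    exists_int_polynomial_dvd_of_aeval_eq_zero hσ (hσd ▸ hd)
  rw [hσd] at hmd
  have i₀ : Fin ν := ⟨0, by omega⟩
  have hfac : ∀ xy ∈ S, ∃ g : ℤ[X], g ≠ 0 ∧
      ∏ i, (X + C (xy.1 i)) - ∏ i, (X + C (xy.2 i)) = m * g := by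
    rintro ⟨x, y⟩ ⟨-, -, heq, -, hdisj⟩
    obtain ⟨g, hg⟩ := hmdvd (∏ i, (X + C (x i)) - ∏ i, (X + C (y i)))
      (by simpa [sub_eq_zero, add_comm] using heq)
    refine ⟨g, ?_, hg⟩
    rintro rfl
    have h1 := congrArg (eval (-y i₀)) hg
    simp only [eval_sub, eval_prod, eval_add, eval_X, eval_C, mul_zero, eval_zero] at h1
    rw [Finset.prod_eq_zero (i := i₀) (f := fun i => -y i₀ + y i) (Finset.mem_univ _) (by simp),
      sub_zero, Finset.prod_eq_zero_iff] at h1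
    obtain ⟨i, -, hi⟩ := h1
    exact hdisj i i₀ (by linarith)
  have hmb : ∀ w : ℤ, 1 ≤ w ∧ w ≤ (h : ℤ) → (m.eval (-w)).natAbs ≤ h ^ (3 * ν + 1) := by
    intro w hw
    obtain ⟨⟨x, y⟩, hxy⟩ := hne
    obtain ⟨g, hg0, hg⟩ := hfac _ hxy
    refine (natAbs_eval_neg_le (by omega) hxy.1 hxy.2.1 hm0 hg0 (hmd ▸ hdν) hg hw).1.trans ?_
    calc 2 ^ (2 * ν + 1) * h ^ ν ≤ h ^ (2 * ν + 1) * h ^ ν := by gcongr; omega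
      _ = h ^ (3 * ν + 1) := by ring
  set R := 2 ^ (2 * ν + 1) * h ^ (ν - d) with hR
  have hRh : R ≤ h ^ (3 * ν + 1) := by
    calc R ≤ h ^ (2 * ν + 1) * h ^ ν := by
          rw [hR]; gcongr <;> omega
      _ = h ^ (3 * ν + 1) := by ring
  let I : Finset ℤ := Finset.Icc 1 h
  let J : Finset ℤ := (Finset.Icc (-(R : ℤ)) R).erase 0
  let U : ℤ × ℤ → Finset (Fin ν → ℤ) := fun bg =>
    Fintype.piFinset fun _ => I.filter fun t => (X + C bg.1).eval (-t) ∣ m.eval (-bg.1) * bg.2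
  let V : (Fin ν → ℤ) → Finset (Fin ν → ℤ) := fun x =>
    Fintype.piFinset fun _ => I.filter fun t => m.eval (-t) ∣ ∏ i, m.eval (-x i)
  have hsub : S ⊆ ((I ×ˢ J).biUnion fun bg => (U bg).biUnion fun x =>
      (V x).image fun y => (x, y) : Finset ((Fin ν → ℤ) × (Fin ν → ℤ))) := by
    rintro ⟨x, y⟩ hxy
    obtain ⟨g, hg0, hg⟩ := hfac _ hxy
    obtain ⟨hx, hy, -, -, hdisj⟩ := hxy
    dsimp only at hx hy hdisj hg
    have hval : ∏ i, (-y i₀ + x i) = m.eval (-y i₀) * g.eval (-y i₀) := by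
      have h1 := congrArg (eval (-y i₀)) hg
      simp only [eval_sub, eval_prod, eval_add, eval_X, eval_C, eval_mul] at h1
      rwa [Finset.prod_eq_zero (i := i₀) (f := fun i => -y i₀ + y i) (Finset.mem_univ _)
        (by simp), sub_zero] at h1
    have hgv : g.eval (-y i₀) ≠ 0 := by
      intro h0
      rw [h0, mul_zero, Finset.prod_eq_zero_iff] at hval
      obtain ⟨i, -, hi⟩ := hval
      exact hdisj i i₀ (by linarith)
    have hgb := (natAbs_eval_neg_le (by omega) hx hy hm0 hg0 (hmd ▸ hdν) hg (hy i₀)).2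
    rw [hmd, ← hR] at hgb
    simp only [Finset.coe_biUnion, Set.mem_iUnion, Finset.mem_coe, Finset.mem_image]
    refine ⟨(y i₀, g.eval (-y i₀)), ?_, x, ?_, y, ?_, rfl⟩
    · simp only [I, J, Finset.mem_product, Finset.mem_Icc, Finset.mem_erase]
      exact ⟨hy i₀, hgv, by omega, by omega⟩
    · simp only [U, I, Fintype.mem_piFinset, Finset.mem_filter, Finset.mem_Icc]
      refine fun i => ⟨hx i, ?_⟩
      rw [← hval]
      have h1 : (X + C (y i₀)).eval (-x i) = -(-y i₀ + x i) := by
        rw [eval_add, eval_X, eval_C]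
        ring
      rw [h1, neg_dvd]
      exact Finset.dvd_prod_of_mem (fun i => -y i₀ + x i) (Finset.mem_univ i)
    · simp only [V, I, Fintype.mem_piFinset, Finset.mem_filter, Finset.mem_Icc]
      refine fun i => ⟨hy i, ?_⟩
      rw [prod_eval_neg_eq hg]
      exact Finset.dvd_prod_of_mem (fun i => m.eval (-y i)) (Finset.mem_univ i)
  refine (Set.ncard_le_ncard hsub (Finset.finite_toSet _)).trans ?_
  rw [Set.ncard_coe_finset]
  have hh1 : 1 ≤ h := by omega
  have hcardI : I.card = h := by simp [I]
  have hcardJ : J.card = 2 * R := by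
    rw [Finset.card_erase_of_mem (by simp), Int.card_Icc]
    omega
  have hcard : (I ×ˢ J).card = h * (2 * R) := by rw [Finset.card_product, hcardI, hcardJ]
  rw [← hcard]
  apply Finset.card_biUnion_le_card_mul
  rintro ⟨b, g⟩ hbg
  simp only [I, J, Finset.mem_product, Finset.mem_Icc, Finset.mem_erase] at hbg
  have hU : (U (b, g)).card ≤ (2 * D) ^ ν := by
    have h1 := card_piFinset_filter_eval_neg_dvd_le (n := ν) (p := X + C b)
      (by rw [natDegree_X_add_C]; exact one_pos)
      (mul_ne_zero (hmroot (-b)) hbg.2.1) I (hD _ (by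
        simpa [Int.natAbs_mul] using ⟨hmroot (-b), hbg.2.1⟩) (by
        rw [Int.natAbs_mul]
        calc (m.eval (-b)).natAbs * g.natAbs ≤ h ^ (3 * ν + 1) * h ^ (3 * ν + 1) :=
              Nat.mul_le_mul (hmb b hbg.1) (le_trans (by omega) hRh)
          _ = h ^ ((3 * ν + 1) * 2) := by rw [← pow_add, mul_two]
          _ ≤ _ := Nat.pow_le_pow_right hh1 (Nat.mul_le_mul_left _ (by omega))))
    rwa [natDegree_X_add_C, mul_one] at h1
  refine (Finset.card_biUnion_le_card_mul _ _ ((2 * d * D) ^ ν) ?_).trans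
    (Nat.mul_le_mul_right _ hU)
  intro x hx
  simp only [U, I, Fintype.mem_piFinset, Finset.mem_filter, Finset.mem_Icc] at hx
  refine Finset.card_image_le.trans ?_
  have hprod : ∏ i, m.eval (-x i) ≠ 0 := Finset.prod_ne_zero_iff.2 fun i _ => hmroot _
  have h1 := card_piFinset_filter_eval_neg_dvd_le (n := ν) (p := m) (by omega) hprod I (hD _
    (by simpa using hprod) (by
      rw [← Int.natAbsHom_apply, map_prod]
      calc ∏ i, (m.eval (-x i)).natAbs ≤ ∏ _i : Fin ν, h ^ (3 * ν + 1) :=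
            Finset.prod_le_prod' fun i _ => hmb _ (hx i).1
        _ = h ^ ((3 * ν + 1) * ν) := by simp [pow_mul]
        _ ≤ _ := Nat.pow_le_pow_right hh1 (Nat.mul_le_mul_left _ (by omega))))
  rwa [hmd] at h1

end

theorem one_lt_log_of_three_le {h : ℕ} (hh : 3 ≤ h) : 1 < Real.log h := by
  rw [Real.lt_log_iff_exp_lt (by positivity)]
  have : (3 : ℝ) ≤ h := by exact_mod_cast hh
  linarith [Real.exp_one_lt_d9]

theorem card_divisors_le_exp_log_div_log_log (k : ℕ) {h : ℕ} (hh : 3 ≤ h) {n : ℕ} (hn : n ≠ 0)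
    (hnk : n ≤ h ^ k) :
    (n.divisors.card : ℝ) ≤
      Real.exp ((4 * k + 16) * (Real.log h / Real.log (Real.log h))) := by
  set L := Real.log h with hL
  have hL1 : 1 < L := one_lt_log_of_three_le hh
  set l := Real.log L with hl
  have hl0 : 0 < l := Real.log_pos hL1
  set z := Real.sqrt L with hz
  have hz1 : 1 < z := by rw [hz]; exact Real.lt_sqrt_of_sq_lt (by simpa using hL1)
  have hzz : z * z = L := Real.mul_self_sqrt (by linarith)
  have hlz : Real.log z = l / 2 := by rw [hz, Real.log_sqrt (by linarith)]
  have hlogn : Real.log n ≤ k * L := by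
    rw [hL, ← Real.log_pow]
    exact Real.log_le_log (by positivity) (by exact_mod_cast hnk)
  rw [Nat.card_divisors hn, Nat.cast_prod, ← Finset.prod_filter_mul_prod_filter_not n.primeFactors
    (fun p : ℕ => (p : ℝ) ≤ z)]
  have hsmall : ∏ p ∈ n.primeFactors with ((p : ℕ) : ℝ) ≤ z, ((n.factorization p + 1 : ℕ) : ℝ) ≤
      Real.exp ((2 * k + 16) * (L / l)) := by
    have hbase : (1 : ℝ) ≤ (2 * k + 1) * L := by nlinarith [(Nat.cast_nonneg k : (0 : ℝ) ≤ k)]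
    have h1 : ∏ p ∈ n.primeFactors with ((p : ℕ) : ℝ) ≤ z, ((n.factorization p + 1 : ℕ) : ℝ) ≤
        ((2 * k + 1) * L) ^ (n.primeFactors.filter fun p : ℕ => (p : ℝ) ≤ z).card := by
      rw [← Finset.prod_const]
      apply Finset.prod_le_prod
      · intros; positivity
      · intro p hp
        have hpp : p.Prime := Nat.prime_of_mem_primeFactors (Finset.mem_filter.1 hp).1
        have h2 : 2 ^ n.factorization p ≤ n :=
          (Nat.pow_le_pow_left hpp.two_le _).trans (Nat.ordProj_le p hn)
        have h3 : (n.factorization p : ℝ) * Real.log 2 ≤ Real.log n := by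
          rw [← Real.log_pow]
          exact Real.log_le_log (by positivity) (by exact_mod_cast h2)
        have := Real.log_two_gt_d9
        have h4 : (0 : ℝ) ≤ n.factorization p := by positivity
        push_cast
        nlinarith
    have h2 : ((n.primeFactors.filter fun p : ℕ => (p : ℝ) ≤ z).card : ℝ) ≤ z := by
      have : (n.primeFactors.filter fun p : ℕ => (p : ℝ) ≤ z) ⊆ Finset.Icc 1 ⌊z⌋₊ := by
        intro p hp
        rw [Finset.mem_filter] at hp
        rw [Finset.mem_Icc]
        exact ⟨(Nat.prime_of_mem_primeFactors hp.1).one_lt.le, Nat.le_floor hp.2⟩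
      have := Finset.card_le_card this
      rw [Nat.card_Icc, Nat.add_sub_cancel] at this
      exact (Nat.cast_le.2 this).trans (Nat.floor_le (by linarith))
    refine h1.trans ?_
    rw [← Real.rpow_natCast, Real.rpow_def_of_pos (by linarith), Real.exp_le_exp]
    have h3 : Real.log ((2 * k + 1) * L) ≤ 2 * k + l := by
      rw [Real.log_mul (by positivity) (by positivity)]
      have := Real.log_le_sub_one_of_pos (x := 2 * (k : ℝ) + 1) (by positivity)
      linarith
    have h4 : l ≤ z := by
      have := Real.log_le_sub_one_of_pos (x := Real.sqrt z) (by positivity)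
      have h5 : Real.sqrt z * Real.sqrt z = z := Real.mul_self_sqrt (by linarith)
      rw [Real.log_sqrt (by linarith), hlz] at this
      nlinarith [sq_nonneg (Real.sqrt z - 2)]
    have h5 : l * l ≤ 16 * z := by
      have := Real.log_le_sub_one_of_pos (x := Real.sqrt z) (by positivity)
      have h5 : Real.sqrt z * Real.sqrt z = z := Real.mul_self_sqrt (by linarith)
      rw [Real.log_sqrt (by linarith), hlz] at this
      nlinarith [Real.sqrt_nonneg z]
    calc Real.log ((2 * k + 1) * L) * _ ≤ (2 * k + l) * z := by
          gcongr
      _ ≤ (2 * k + 16) * (L / l) := by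
          rw [← mul_div_assoc, le_div_iff₀ hl0, ← hzz]
          have hk : (0 : ℝ) ≤ k := by positivity
          nlinarith [mul_le_mul_of_nonneg_left h4 hk, mul_le_mul_of_nonneg_right
            (add_le_add (mul_le_mul_of_nonneg_left h4 hk) h5) (by linarith : (0:ℝ) ≤ z),
            mul_nonneg (mul_nonneg hk (sub_nonneg.2 h4)) (by linarith : (0:ℝ) ≤ z)]
  have hlarge : ∏ p ∈ n.primeFactors with ¬ ((p : ℕ) : ℝ) ≤ z, ((n.factorization p + 1 : ℕ) : ℝ) ≤
      Real.exp (2 * k * (L / l)) := by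
    set T := n.primeFactors.filter fun p : ℕ => ¬ (p : ℝ) ≤ z
    set a := ∑ p ∈ T, n.factorization p with ha
    have h1 : ∏ p ∈ T, ((n.factorization p + 1 : ℕ) : ℝ) ≤ 2 ^ a := by
      rw [ha, ← Finset.prod_pow_eq_pow_sum]
      apply Finset.prod_le_prod
      · intros; positivity
      · intro p _
        exact_mod_cast Nat.lt_two_pow_self
    have h2 : z ^ a ≤ n := by
      rw [ha, ← Finset.prod_pow_eq_pow_sum]
      calc ∏ p ∈ T, z ^ n.factorization p ≤ ∏ p ∈ T, ((p ^ n.factorization p : ℕ) : ℝ) := by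
            apply Finset.prod_le_prod
            · intros; positivity
            · intro p hp
              rw [Nat.cast_pow]
              gcongr
              exact (not_le.1 (Finset.mem_filter.1 hp).2).le
        _ = ((∏ p ∈ T, p ^ n.factorization p : ℕ) : ℝ) := by push_cast; rfl
        _ ≤ n := by
            rw [Nat.cast_le]
            conv_rhs => rw [← Nat.prod_factorization_pow_eq_self hn]
            apply Finset.prod_le_prod_of_subset_of_one_le' (Finset.filter_subset _ _)
            intro p hp _
            exact Nat.one_le_pow _ _ (Nat.prime_of_mem_primeFactors hp).pos
    have h3 : (a : ℝ) * (l / 2) ≤ k * L := by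
      rw [← hlz, ← Real.log_pow]
      exact (Real.log_le_log (by positivity) h2).trans hlogn
    refine h1.trans ?_
    rw [← Real.rpow_natCast, Real.rpow_def_of_pos (by norm_num), Real.exp_le_exp]
    calc Real.log 2 * a ≤ 1 * a := by
          gcongr
          linarith [Real.log_two_lt_d9]
      _ ≤ 2 * k * (L / l) := by
          rw [← mul_div_assoc, le_div_iff₀ hl0]
          linarith
  calc _ ≤ Real.exp ((2 * k + 16) * (L / l)) * Real.exp (2 * k * (L / l)) := by
        gcongr
    _ = _ := by rw [← Real.exp_add]; ring_nf


/-- For fixed `ν ≥ d ≥ 2` there is `C = C(ν) > 0` such that for every `h ≥ 3` and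
every algebraic `σ ∈ ℂ` of degree `d` over `ℚ`, the number of solutions of
`(x₁+σ)⋯(x_ν+σ) = (y₁+σ)⋯(y_ν+σ) ≠ 0` with `1 ≤ xᵢ, yᵢ ≤ h` and
`{x₁,…,x_ν} ∩ {y₁,…,y_ν} = ∅` is at most `h^{ν−d+1}·exp(C log h / log log h)`. -/
theorem stmt19 (ν d : ℕ) (hd : 2 ≤ d) (hdν : d ≤ ν) :
    ∃ C : ℝ, 0 < C ∧ ∀ h : ℕ, 3 ≤ h → ∀ σ : ℂ,
      IsIntegral ℚ σ → (minpoly ℚ σ).natDegree = d →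
      (Set.ncard {xy : (Fin ν → ℤ) × (Fin ν → ℤ) |
          (∀ i, 1 ≤ xy.1 i ∧ xy.1 i ≤ (h : ℤ)) ∧
          (∀ i, 1 ≤ xy.2 i ∧ xy.2 i ≤ (h : ℤ)) ∧
          (∏ i, ((xy.1 i : ℂ) + σ)) = (∏ i, ((xy.2 i : ℂ) + σ)) ∧
          (∏ i, ((xy.1 i : ℂ) + σ)) ≠ 0 ∧
          (∀ i j, xy.1 i ≠ xy.2 j)} : ℝ)
        ≤ (h : ℝ) ^ (ν - d + 1) * Real.exp (C * Real.log h / Real.log (Real.log h)) := by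
  set k := (3 * ν + 1) * (ν + 2) with hk
  set K : ℝ := 2 ^ (4 * ν + 2) * (d : ℝ) ^ ν with hK
  have hd1 : (1 : ℝ) ≤ d := by exact_mod_cast (by omega : 1 ≤ d)
  have hK1 : 1 ≤ K := one_le_mul_of_one_le_of_one_le (one_le_pow₀ (by norm_num)) (one_le_pow₀ hd1)
  have hν0 : (0 : ℝ) < ν := by exact_mod_cast (by omega : 0 < ν)
  refine ⟨Real.log K + 2 * ν * (4 * k + 16),
    add_pos_of_nonneg_of_pos (Real.log_nonneg hK1) (by positivity), ?_⟩
  intro h hh σ hσ hσd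
  have hL1 := one_lt_log_of_three_le hh
  set Q := Real.log h / Real.log (Real.log h) with hQ
  have hQ1 : 1 ≤ Q := by
    rw [hQ, one_le_div (Real.log_pos hL1)]
    linarith [Real.log_le_sub_one_of_pos (by linarith : 0 < Real.log h)]
  set E := Real.exp ((4 * k + 16) * Q) with hE
  have hD : ∀ n : ℕ, n ≠ 0 → n ≤ h ^ k → n.divisors.card ≤ ⌊E⌋₊ := fun n hn hnk =>
    Nat.le_floor (card_divisors_le_exp_log_div_log_log k hh hn hnk)
  have hfl : (⌊E⌋₊ : ℝ) ≤ E := Nat.floor_le (Real.exp_pos _).le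
  refine (Nat.cast_le.2 (ncard_prod_eq_prod_le hd hdν hh hσ hσd hD)).trans ?_
  push_cast
  calc (h : ℝ) * (2 * (2 ^ (2 * ν + 1) * h ^ (ν - d))) *
        ((2 * ⌊E⌋₊) ^ ν * (2 * d * ⌊E⌋₊) ^ ν)
      ≤ (h : ℝ) * (2 * (2 ^ (2 * ν + 1) * h ^ (ν - d))) * ((2 * E) ^ ν * (2 * d * E) ^ ν) := by
        gcongr
    _ = (h : ℝ) ^ (ν - d + 1) * (K * E ^ (2 * ν)) := by
        rw [hK]; ring
    _ ≤ (h : ℝ) ^ (ν - d + 1) *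
        (Real.exp (Real.log K * Q) * Real.exp (2 * ν * ((4 * k + 16) * Q))) := by
        gcongr
        · rw [← Real.log_le_iff_le_exp (by linarith)]
          exact le_mul_of_one_le_right (Real.log_nonneg hK1) hQ1
        · rw [hE, ← Real.exp_nat_mul]
          push_cast
          exact le_rfl
    _ = _ := by
        rw [← Real.exp_add, mul_div_assoc, ← hQ]
        ring_nf
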